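/- arXiv:0809.4560 — 2 statements merged into one kernel-verified Lean document; each statement's English description precedes it below -/
import Mathlib

section
/- Let h, q ∈ H²₀ satisfy q(s,t) ≥ h(s,t) for all s,t ∈ [0,1]. If h̲ = h and q̲ = q (i.e., both h and q coincide with their projections onto the polar cone Ṽ), then ‖q‖ ≥ ‖h‖. -/
open MeasureTheory Set Filter
open scoped ProbabilityTheory

set_option linter.unusedVariables false

noncomputable section

/-- The closed unit square `[0,1]²` in `ℝ × ℝ`. -/
def unitSq : Set (ℝ × ℝ) := Icc (0:ℝ) 1 ×ˢ Icc (0:ℝ) 1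

/-- The inner product of the RKHS `H²₀`, expressed on the (partial) derivatives. -/
def inner2 (f g : ℝ × ℝ → ℝ) : ℝ := ∫ p in unitSq, f p * g p

/-- The norm of the RKHS `H²₀`, expressed on the (partial) derivatives. -/
def norm2 (f : ℝ × ℝ → ℝ) : ℝ := Real.sqrt (∫ p in unitSq, (f p) ^ 2)

/-- `IsH20 h hd` means `h ∈ H²₀` with (square-integrable) partial derivative `h'' = hd`:
`h(s,t) = ∫_{[0,s]×[0,t]} h''(x,y) λ²(dx,dy)` and `h` vanishes on the boundary of `[0,1]²`. -/
structure IsH20 (h hd : ℝ × ℝ → ℝ) : Prop where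
  sq_int : IntegrableOn (fun p => (hd p) ^ 2) unitSq volume
  repr : ∀ s ∈ Icc (0:ℝ) 1, ∀ t ∈ Icc (0:ℝ) 1,
      h (s, t) = ∫ p in Icc (0:ℝ) s ×ˢ Icc (0:ℝ) t, hd p
  bdry : ∀ s ∈ Icc (0:ℝ) 1, h (0, s) = 0 ∧ h (1, s) = 0 ∧ h (s, 0) = 0 ∧ h (s, 1) = 0

/-- Membership in `V ⊆ H²₀`: nonpositive on the unit square. -/
def InV (h : ℝ × ℝ → ℝ) : Prop := ∀ p ∈ unitSq, h p ≤ 0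

/-- Membership in the polar cone `Ṽ := {g ∈ H²₀ : ⟨g, v⟩ ≤ 0 ∀ v ∈ V}` of `V`. -/
def InPolarV (g gd : ℝ × ℝ → ℝ) : Prop :=
  IsH20 g gd ∧ ∀ v vd, IsH20 v vd → InV v → inner2 gd vd ≤ 0

/-- Membership in the polar cone `W̃ := {g ∈ H²₀ : ⟨g, w⟩ ≥ 0 ∀ w ∈ W}` of
`W = {h ∈ H²₀ : h ≥ 0}`. -/
def InPolarW (g gd : ℝ × ℝ → ℝ) : Prop :=
  IsH20 g gd ∧ ∀ w wd, IsH20 w wd → (∀ p ∈ unitSq, 0 ≤ w p) → 0 ≤ inner2 gd wd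

/-- `pr` (with derivative `prd`) is the metric projection onto `Ṽ` of `h ∈ H²₀`
(with derivative `hd`): `pr ∈ Ṽ` and `pr` minimises the `H²₀`-distance to `h` over `Ṽ`. -/
def IsProjPolarV (h hd pr prd : ℝ × ℝ → ℝ) : Prop :=
  InPolarV pr prd ∧ ∀ g gd, InPolarV g gd →
    norm2 (fun q => hd q - prd q) ≤ norm2 (fun q => hd q - gd q)

/-- `pr` (with derivative `prd`) is the metric projection onto `W̃` of `h ∈ H²₀`
(with derivative `hd`). -/
def IsProjPolarW (h hd pr prd : ℝ × ℝ → ℝ) : Prop :=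
  InPolarW pr prd ∧ ∀ g gd, InPolarW g gd →
    norm2 (fun q => hd q - prd q) ≤ norm2 (fun q => hd q - gd q)

theorem Icc_prod_Icc_subset_unitSq {s t : ℝ} (hs : s ∈ Icc (0:ℝ) 1) (ht : t ∈ Icc (0:ℝ) 1) :
    Icc (0:ℝ) s ×ˢ Icc (0:ℝ) t ⊆ unitSq :=
  prod_mono (Icc_subset_Icc_right hs.2) (Icc_subset_Icc_right ht.2)

instance isFiniteMeasure_restrict_unitSq :
    IsFiniteMeasure ((volume : Measure (ℝ × ℝ)).restrict unitSq) :=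
  isFiniteMeasure_restrict.2 (isCompact_Icc.prod isCompact_Icc).measure_lt_top.ne

/-- The common part of the measurable hulls of the positivity and the negativity set of `f`:
the largest set on which the sign of `f` is nowhere measurable. -/
def signAmbiguitySet {α : Type*} [MeasurableSpace α] (μ : Measure α) (f : α → ℝ) : Set α :=
  toMeasurable μ {x | 0 < f x} ∩ toMeasurable μ {x | f x < 0}

section SignAmbiguity

variable {α : Type*} [MeasurableSpace α] {μ : Measure α} {f : α → ℝ}

theorem signAmbiguitySet_measurableSet : MeasurableSet (signAmbiguitySet μ f) :=
  (measurableSet_toMeasurable _ _).inter (measurableSet_toMeasurable _ _)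

theorem measure_pos_inter_signAmbiguitySet [IsFiniteMeasure μ] {R : Set α}
    (hR : MeasurableSet R) :
    μ ({x | 0 < f x} ∩ signAmbiguitySet μ f ∩ R) = μ (signAmbiguitySet μ f ∩ R) := by
  have h := Measure.measure_toMeasurable_inter (μ := μ) (t := {x | 0 < f x})
    ((measurableSet_toMeasurable μ {x | f x < 0}).inter hR) (measure_ne_top _ _)
  rw [← inter_assoc, ← inter_assoc] at h
  rw [signAmbiguitySet, ← inter_assoc,
    inter_eq_self_of_subset_left (subset_toMeasurable μ {x | 0 < f x}), ← h]

theorem measure_neg_inter_signAmbiguitySet [IsFiniteMeasure μ] {R : Set α}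
    (hR : MeasurableSet R) :
    μ ({x | f x < 0} ∩ signAmbiguitySet μ f ∩ R) = μ (signAmbiguitySet μ f ∩ R) := by
  have h := measure_pos_inter_signAmbiguitySet (μ := μ) (f := fun x => -f x) hR
  simpa [signAmbiguitySet, inter_comm (toMeasurable μ {x | 0 < f x})] using h

theorem measure_signAmbiguitySet_inter_eq_zero [IsFiniteMeasure μ] {R : Set α}
    (hR : MeasurableSet R)
    (hf : AEMeasurable ((signAmbiguitySet μ f).indicator f) (μ.restrict R)) :
    μ (signAmbiguitySet μ f ∩ R) = 0 := by
  set B := signAmbiguitySet μ f with hB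
  have hpos : {x | 0 < f x} ∩ B = B.indicator f ⁻¹' Ioi 0 := by
    ext x; by_cases hx : x ∈ B <;> simp [hx]
  have hneg : {x | f x < 0} ∩ B = B.indicator f ⁻¹' Iio 0 := by
    ext x; by_cases hx : x ∈ B <;> simp [hx]
  have hNnull : NullMeasurableSet ({x | f x < 0} ∩ B) (μ.restrict R) :=
    hneg ▸ hf.nullMeasurable measurableSet_Iio
  have hdisj : Disjoint ({x | 0 < f x} ∩ B) ({x | f x < 0} ∩ B) := by
    rw [Set.disjoint_left]
    rintro x ⟨h1, -⟩ ⟨h2, -⟩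
    exact lt_asymm (mem_ofPred.1 h1) (mem_ofPred.1 h2)
  have hunion := measure_union₀ hNnull hdisj.aedisjoint
  have hle : (μ.restrict R) ({x | 0 < f x} ∩ B ∪ {x | f x < 0} ∩ B) ≤ μ (B ∩ R) := by
    rw [Measure.restrict_apply' hR]
    exact measure_mono (inter_subset_inter_left _ (union_subset inter_subset_right
      inter_subset_right))
  rw [hunion, Measure.restrict_apply' hR, Measure.restrict_apply' hR,
    measure_pos_inter_signAmbiguitySet hR, measure_neg_inter_signAmbiguitySet hR, ← hB] at hle
  by_contra h0
  exact hle.not_gt (ENNReal.lt_add_right (measure_ne_top _ _) h0)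

theorem setIntegral_indicator_signAmbiguitySet [IsFiniteMeasure μ] {R : Set α}
    (hR : MeasurableSet R) :
    ∫ x in R, (signAmbiguitySet μ f).indicator f x ∂μ = 0 := by
  by_cases hf : AEMeasurable ((signAmbiguitySet μ f).indicator f) (μ.restrict R)
  · have h0 := measure_signAmbiguitySet_inter_eq_zero hR hf
    rw [setIntegral_indicator signAmbiguitySet_measurableSet, inter_comm,
      setIntegral_measure_zero _ h0]
  · exact integral_non_aestronglyMeasurable fun h => hf h.aemeasurable

theorem aemeasurable_of_measure_signAmbiguitySet_eq_zero
    (hsq : AEMeasurable (fun x => f x ^ 2) μ) (h0 : μ (signAmbiguitySet μ f) = 0) :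
    AEMeasurable f μ := by
  set T := toMeasurable μ {x | 0 < f x} with hT
  have hTm : MeasurableSet T := measurableSet_toMeasurable _ _
  have hsqrt : AEMeasurable (fun x => √(f x ^ 2)) μ := hsq.sqrt
  have hg : AEMeasurable
      (fun x => T.indicator (fun _ => (1 : ℝ)) x * √(f x ^ 2) -
        Tᶜ.indicator (fun _ => (1 : ℝ)) x * √(f x ^ 2)) μ :=
    ((measurable_const.indicator hTm).aemeasurable.mul hsqrt).sub
      ((measurable_const.indicator hTm.compl).aemeasurable.mul hsqrt)
  refine hg.congr ?_
  filter_upwards [measure_eq_zero_iff_ae_notMem.1 h0] with x hx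
  rw [Real.sqrt_sq_eq_abs]
  rcases lt_trichotomy (f x) 0 with h | h | h
  · have hxT : x ∉ T := fun hxT => hx ⟨hxT, subset_toMeasurable μ _ h⟩
    simp [hxT, abs_of_neg h]
  · simp [h]
  · have hxT : x ∈ T := subset_toMeasurable μ _ h
    simp [hxT, abs_of_pos h]

end SignAmbiguity

theorem IsH20.integrable_sq {g gd : ℝ × ℝ → ℝ} (hg : IsH20 g gd) :
    Integrable (fun p => gd p ^ 2) (volume.restrict unitSq) := hg.sq_int

/-- The definition of `IsH20` asks for measurability of the square of the derivative only;
for members of the polar cone the derivative itself is measurable. -/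
theorem InPolarV.aemeasurable {g gd : ℝ × ℝ → ℝ} (hg : InPolarV g gd) :
    AEMeasurable gd (volume.restrict unitSq) := by
  set μ := (volume : Measure (ℝ × ℝ)).restrict unitSq with hμ
  set B := signAmbiguitySet μ gd with hB
  have hBm : MeasurableSet B := signAmbiguitySet_measurableSet
  have hsq := hg.1.integrable_sq
  have hind : ∀ p, B.indicator gd p ^ 2 = B.indicator (fun p => gd p ^ 2) p := fun p => by
    by_cases hp : p ∈ B <;> simp [hp]
  have hmul : ∀ p, gd p * B.indicator gd p = B.indicator (fun p => gd p ^ 2) p := fun p => by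
    by_cases hp : p ∈ B <;> simp [hp, sq]
  have hzero : IsH20 (fun _ => 0) (B.indicator gd) := by
    refine ⟨?_, fun s hs t ht => ?_, fun _ _ => ⟨rfl, rfl, rfl, rfl⟩⟩
    · simp_rw [hind]
      exact hsq.indicator hBm
    · have hR : MeasurableSet (Icc (0:ℝ) s ×ˢ Icc (0:ℝ) t) :=
        measurableSet_Icc.prod measurableSet_Icc
      rw [← Measure.restrict_restrict_of_subset (Icc_prod_Icc_subset_unitSq hs ht)]
      exact (setIntegral_indicator_signAmbiguitySet hR).symm
  have hle : ∫ p, B.indicator (fun p => gd p ^ 2) p ∂μ ≤ 0 := by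
    have h := hg.2 _ _ hzero fun _ _ => le_rfl
    simpa only [inner2, hmul] using h
  have hnonneg : 0 ≤ B.indicator (fun p => gd p ^ 2) :=
    indicator_nonneg fun p _ => sq_nonneg _
  have hae := (integral_eq_zero_iff_of_nonneg hnonneg (hsq.indicator hBm)).1
    (hle.antisymm (integral_nonneg hnonneg))
  have hPB : μ ({p | 0 < gd p} ∩ B) = 0 := by
    rw [measure_eq_zero_iff_ae_notMem]
    filter_upwards [hae] with p hp hpB
    rw [indicator_of_mem hpB.2] at hp
    exact hpB.1.ne' (pow_eq_zero_iff two_ne_zero |>.1 hp)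
  have hB0 := measure_pos_inter_signAmbiguitySet (μ := μ) (f := gd) MeasurableSet.univ
  rw [inter_univ, inter_univ, ← hB, hPB] at hB0
  exact aemeasurable_of_measure_signAmbiguitySet_eq_zero hsq.aemeasurable hB0.symm

theorem InPolarV.memLp {g gd : ℝ × ℝ → ℝ} (hg : InPolarV g gd) :
    MemLp gd 2 (volume.restrict unitSq) :=
  (memLp_two_iff_integrable_sq hg.aemeasurable.aestronglyMeasurable).2 hg.1.integrable_sq

theorem IsH20.sub {h hd q qd : ℝ × ℝ → ℝ} (hh : IsH20 h hd) (hq : IsH20 q qd)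
    (hhd : MemLp hd 2 (volume.restrict unitSq)) (hqd : MemLp qd 2 (volume.restrict unitSq)) :
    IsH20 (fun p => h p - q p) (fun p => hd p - qd p) := by
  refine ⟨(hhd.sub hqd).integrable_sq, fun s hs t ht => ?_, fun s hs => ?_⟩
  · have hsub := Icc_prod_Icc_subset_unitSq hs ht
    have h1 : IntegrableOn hd unitSq := hhd.integrable one_le_two
    have h2 : IntegrableOn qd unitSq := hqd.integrable one_le_two
    rw [integral_sub (h1.mono_set hsub) (h2.mono_set hsub), hh.repr s hs t ht, hq.repr s hs t ht]
  · obtain ⟨a1, a2, a3, a4⟩ := hh.bdry s hs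
    obtain ⟨b1, b2, b3, b4⟩ := hq.bdry s hs
    simp [a1, a2, a3, a4, b1, b2, b3, b4]

/-- Let `h, q ∈ H²₀` with `q ≥ h` pointwise on `[0,1]²`. If `h̲ = h` and
`q̲ = q`, i.e. both `h` and `q` coincide with their metric projections onto the polar cone `Ṽ`,
then `‖q‖ ≥ ‖h‖`. -/
theorem stmt5 (h hd q qd : ℝ × ℝ → ℝ)
    (hh : IsH20 h hd) (hq : IsH20 q qd)
    (hle : ∀ p ∈ unitSq, h p ≤ q p)
    (hprojh : IsProjPolarV h hd h hd) (hprojq : IsProjPolarV q qd q qd) :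
    norm2 hd ≤ norm2 qd := by
  have hhd := hprojh.1.memLp
  have hqd := hprojq.1.memLp
  have hpolar : inner2 hd (fun p => hd p - qd p) ≤ 0 :=
    hprojh.1.2 _ _ (hh.sub hq hhd hqd) fun p hp => sub_nonpos.2 (hle p hp)
  refine Real.sqrt_le_sqrt ?_
  have hmono : ∫ p in unitSq, (hd p ^ 2 - qd p ^ 2) ≤ ∫ p in unitSq, 2 * (hd p * (hd p - qd p)) :=
    integral_mono (hhd.integrable_sq.sub hqd.integrable_sq)
      ((hhd.integrable_mul (hhd.sub hqd)).const_mul 2)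
      fun p => by
        change hd p ^ 2 - qd p ^ 2 ≤ 2 * (hd p * (hd p - qd p))
        nlinarith [sq_nonneg (hd p - qd p)]
  rw [integral_sub hhd.integrable_sq hqd.integrable_sq, integral_const_mul] at hmono
  unfold inner2 at hpolar
  linarith

end
end

section
/- Let h₁, h₂ ∈ H¹₀ be such that their smallest concave majorants h̃₁, h̃₂ belong to H¹₀ and h̃₁(s)h̃₂(t) ≥ h₁(s)h₂(t) for all s,t ∈ [0,1]. Let νᵢ be the Lebesgue–Stieltjes measure on [0,1] generated by the nondecreasing right-continuous function −h̃ᵢ' (i = 1,2), and let uᵢ, lᵢ : [0,1] → ℝ be measurable and νᵢ-integrable. Set h(s,t) := h₁(s)h₂(t), h̃(s,t) := h̃₁(s)h̃₂(t), u(s,t) := u₁(s)u₂(t), and assume ψ(u;0) ∈ (0,1). Then ψ(u;h) ≤ ψ(u; h − h̃) · exp(−‖h̃₁‖²‖h̃₂‖²/2 + ∏_{i=1,2} ∫_{[0,1]} uᵢ dνᵢ), and ψ(u;h) ≥ P(l₁(s)l₂(t) ≤ B₀(s,t) ≤ u₁(s)u₂(t) for all s,t ∈ [0,1]) · exp(−‖h̃₁‖²‖h̃₂‖²/2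 + ∏_{i=1,2} ∫_{[0,1]} lᵢ dνᵢ). -/
open MeasureTheory Set Filter
open scoped ProbabilityTheory

set_option linter.unusedVariables false

noncomputable section

/-- A Brownian pillow with continuous sample paths on the probability space `(Ω, F, ℙ)`:
a centered Gaussian random field (every finite linear combination of values is a centered
Gaussian random variable) with continuous sample paths and covariance
`E[B(s₁,t₁)B(s₂,t₂)] = (min(s₁,s₂) − s₁s₂)(min(t₁,t₂) − t₁t₂)` on `[0,1]²`. -/
def IsBrownianPillow {Ω : Type*} [MeasureSpace Ω] (B : ℝ × ℝ → Ω → ℝ) : Prop :=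
  (∀ ω, Continuous fun p => B p ω) ∧
  (∀ (n : ℕ) (c : Fin n → ℝ) (pts : Fin n → ℝ × ℝ), ∃ v : NNReal,
      Measure.map (fun ω => ∑ i, c i * B (pts i) ω) ℙ = ProbabilityTheory.gaussianReal 0 v) ∧
  (∀ p ∈ unitSq, ∀ q ∈ unitSq,
      (∫ ω, B p ω * B q ω) = (min p.1 q.1 - p.1 * q.1) * (min p.2 q.2 - p.2 * q.2))

/-- The boundary non-crossing probability
`ψ(u; h) := P(B₀(s,t) + h(s,t) ≤ u(s,t) for all s,t ∈ [0,1])`. -/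
def psi {Ω : Type*} [MeasureSpace Ω] (B : ℝ × ℝ → Ω → ℝ) (u h : ℝ × ℝ → ℝ) : ℝ :=
  (ℙ {ω | ∀ p ∈ unitSq, B p ω + h p ≤ u p}).toReal

/-- The standard normal distribution function `Φ`. -/
def stdNormalCDF (x : ℝ) : ℝ := ∫ t in Iic x, Real.exp (-t ^ 2 / 2) / Real.sqrt (2 * Real.pi)

/-- `IsH10 h hd`: `h ∈ H¹₀`, with square-integrable derivative `h' = hd` satisfying
`h(s) = ∫_{[0,s]} h'(x) λ(dx)` and `h(0) = h(1) = 0`. -/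
structure IsH10 (h hd : ℝ → ℝ) : Prop where
  sq_int : IntegrableOn (fun x => (hd x) ^ 2) (Icc (0:ℝ) 1) volume
  repr : ∀ s ∈ Icc (0:ℝ) 1, h s = ∫ x in Icc (0:ℝ) s, hd x
  zero : h 0 = 0
  one : h 1 = 0

/-- The norm of `H¹₀`, expressed on derivatives. -/
def norm1 (f : ℝ → ℝ) : ℝ := Real.sqrt (∫ x in Icc (0:ℝ) 1, (f x) ^ 2)

/-- `g` is the smallest concave majorant of `h` on `[0,1]`. -/
def IsSCM (h g : ℝ → ℝ) : Prop :=
  ConcaveOn ℝ (Icc (0:ℝ) 1) g ∧ (∀ x ∈ Icc (0:ℝ) 1, h x ≤ g x) ∧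
    ∀ k : ℝ → ℝ, ConcaveOn ℝ (Icc (0:ℝ) 1) k → (∀ x ∈ Icc (0:ℝ) 1, h x ≤ k x) →
      ∀ x ∈ Icc (0:ℝ) 1, g x ≤ k x

/-- `ν` is the Lebesgue–Stieltjes measure on `[0,1]` generated by the nondecreasing
right-continuous function `−f` (here `f` is a right-continuous version of the derivative of a
concave function, so `−f` is nondecreasing): `ν((a,b]) = (−f)(b) − (−f)(a)` for
`0 ≤ a ≤ b ≤ 1`, `ν` is finite and carried by `[0,1]`. -/
def GeneratesMeasure1 (f : ℝ → ℝ) (ν : Measure ℝ) : Prop :=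
  (∀ x, ContinuousWithinAt f (Ici x) x) ∧
  (∀ x ∈ Icc (0:ℝ) 1, ∀ y ∈ Icc (0:ℝ) 1, x ≤ y → -f x ≤ -f y) ∧
  IsFiniteMeasure ν ∧ ν (Icc (0:ℝ) 1)ᶜ = 0 ∧
  ∀ a b : ℝ, 0 ≤ a → a ≤ b → b ≤ 1 → (ν (Ioc a b)).toReal = -f b - -f a

section CameronMartin

open ProbabilityTheory Topology

/-- A pointwise limit of centered real Gaussian variables is a centered Gaussian variable. -/
lemma exists_map_eq_gaussianReal_of_tendsto {Ω : Type*} {mΩ : MeasurableSpace Ω} {P : Measure Ω}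
    [IsProbabilityMeasure P] {Y : ℕ → Ω → ℝ} {Z : Ω → ℝ}
    (hY : ∀ n, ∃ v : NNReal, P.map (Y n) = gaussianReal 0 v)
    (hlim : ∀ ω, Tendsto (fun n => Y n ω) atTop (𝓝 (Z ω))) :
    ∃ v : NNReal, P.map Z = gaussianReal 0 v := by
  choose v hv using hY
  have hYm : ∀ n, AEMeasurable (Y n) P := fun n =>
    aemeasurable_of_map_neZero (by rw [hv]; infer_instance)
  have hZm : AEMeasurable Z P :=
    aemeasurable_of_tendsto_metrizable_ae atTop hYm (ae_of_all _ hlim)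
  have : IsProbabilityMeasure (P.map Z) := Measure.isProbabilityMeasure_map hZm
  have hcf : ∀ t : ℝ, Tendsto (fun n => ((Real.exp (-(v n * t ^ 2 / 2)) : ℝ) : ℂ)) atTop
      (𝓝 (charFun (P.map Z) t)) := by
    intro t
    have h1 : ∀ n, ((Real.exp (-(v n * t ^ 2 / 2)) : ℝ) : ℂ)
        = ∫ ω, Complex.exp (t * Y n ω * Complex.I) ∂P := by
      intro n
      have := charFun_gaussianReal (μ := 0) (v := v n) t
      rw [← hv, charFun_apply_real, integral_map (hYm n) (by fun_prop)] at this
      rw [this]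
      push_cast
      congr 1
      ring
    simp_rw [h1]
    rw [charFun_apply_real, integral_map hZm (by fun_prop)]
    refine tendsto_integral_of_dominated_convergence (fun _ => 1) (fun n => ?_)
      (integrable_const _) (fun n => ae_of_all _ fun ω => ?_) (ae_of_all _ fun ω => ?_)
    · exact (Continuous.aestronglyMeasurable (by fun_prop :
        Continuous fun x : ℝ => Complex.exp (t * x * Complex.I))).comp_aemeasurable (hYm n)
    · rw [show (t * Y n ω * Complex.I : ℂ) = ((t * Y n ω : ℝ) : ℂ) * Complex.I by push_cast; ring,
        Complex.norm_exp_ofReal_mul_I]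
    · exact ((by fun_prop : Continuous fun x : ℝ => Complex.exp (t * x * Complex.I)).tendsto
        _).comp (hlim ω)
  obtain ⟨t, ht0, ht⟩ : ∃ t : ℝ, t ≠ 0 ∧ charFun (P.map Z) t ≠ 0 := by
    have hc : ContinuousAt (charFun (P.map Z)) 0 := (continuous_charFun).continuousAt
    have h0 : charFun (P.map Z) 0 ≠ 0 := by simp
    have h1 : ∀ᶠ t in 𝓝[≠] (0 : ℝ), charFun (P.map Z) t ≠ 0 :=
      (hc.eventually_ne h0).filter_mono nhdsWithin_le_nhds
    obtain ⟨t, ht, ht'⟩ := (h1.and self_mem_nhdsWithin).exists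
    exact ⟨t, ht', ht⟩
  have hvlim : Tendsto (fun n => (v n : ℝ)) atTop
      (𝓝 (-(Real.log ‖charFun (P.map Z) t‖) * 2 / t ^ 2)) := by
    have h1 := ((hcf t).norm.log (norm_ne_zero_iff.2 ht)).neg.mul_const 2 |>.div_const (t ^ 2)
    refine h1.congr fun n => ?_
    rw [Complex.norm_real, Real.norm_eq_abs, abs_of_pos (Real.exp_pos _), Real.log_exp]
    field_simp
  set w := -(Real.log ‖charFun (P.map Z) t‖) * 2 / t ^ 2
  have hw : 0 ≤ w := ge_of_tendsto' hvlim fun n => (v n).2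
  obtain ⟨w', hw'⟩ : ∃ w' : NNReal, (w' : ℝ) = w := ⟨⟨w, hw⟩, rfl⟩
  refine ⟨w', Measure.ext_of_charFun ?_⟩
  ext x
  refine tendsto_nhds_unique (hcf x) ?_
  rw [charFun_gaussianReal]
  have h2 : Tendsto (fun n => Real.exp (-(v n * x ^ 2 / 2))) atTop
      (𝓝 (Real.exp (-(w * x ^ 2 / 2)))) :=
    (Real.continuous_exp.tendsto _).comp (((hvlim.mul_const _).div_const _).neg)
  have h3 : Complex.exp (x * (0 : ℝ) * Complex.I - w' * x ^ 2 / 2)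
      = ((Real.exp (-(w * x ^ 2 / 2)) : ℝ) : ℂ) := by
    rw [← hw']
    push_cast
    congr 1
    ring
  rw [h3]
  exact (Complex.continuous_ofReal.tendsto _).comp h2

/-- The random variables that are pointwise limits of sequences in a space of random variables. -/
def seqLimits {Ω : Type*} (M : Submodule ℝ (Ω → ℝ)) : Submodule ℝ (Ω → ℝ) where
  carrier := {Z | ∃ Y : ℕ → Ω → ℝ, (∀ n, Y n ∈ M) ∧
    ∀ ω, Tendsto (fun n => Y n ω) atTop (𝓝 (Z ω))}
  add_mem' := by
    rintro _ _ ⟨Y, hY, hl⟩ ⟨Y', hY', hl'⟩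
    exact ⟨fun n => Y n + Y' n, fun n => M.add_mem (hY n) (hY' n),
      fun ω => (hl ω).add (hl' ω)⟩
  zero_mem' := ⟨fun _ => 0, fun _ => M.zero_mem, fun _ => tendsto_const_nhds⟩
  smul_mem' := by
    rintro c _ ⟨Y, hY, hl⟩
    exact ⟨fun n => c • Y n, fun n => M.smul_mem c (hY n), fun ω => (hl ω).const_smul c⟩

lemma le_seqLimits {Ω : Type*} (M : Submodule ℝ (Ω → ℝ)) : M ≤ seqLimits M :=
  fun Y hY => ⟨fun _ => Y, fun _ => hY, fun _ => tendsto_const_nhds⟩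

/-- A space of random variables all of which are centered Gaussian. -/
def IsCenteredGaussianSpace {Ω : Type*} {mΩ : MeasurableSpace Ω} (M : Submodule ℝ (Ω → ℝ))
    (P : Measure Ω) : Prop :=
  ∀ Y ∈ M, ∃ v : NNReal, P.map Y = gaussianReal 0 v

namespace IsCenteredGaussianSpace

variable {Ω : Type*} {mΩ : MeasurableSpace Ω} {P : Measure Ω} {M : Submodule ℝ (Ω → ℝ)}

protected lemma seqLimits [IsProbabilityMeasure P] (hM : IsCenteredGaussianSpace M P) :
    IsCenteredGaussianSpace (seqLimits M) P := by
  rintro Z ⟨Y, hY, hl⟩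
  exact exists_map_eq_gaussianReal_of_tendsto (fun n => hM _ (hY n)) hl

lemma hasGaussianLaw (hM : IsCenteredGaussianSpace M P) {Y : Ω → ℝ} (hY : Y ∈ M) :
    HasGaussianLaw Y P := by
  obtain ⟨v, hv⟩ := hM Y hY
  exact ⟨by rw [hv]; infer_instance⟩

lemma integral_eq_zero (hM : IsCenteredGaussianSpace M P) {Y : Ω → ℝ} (hY : Y ∈ M) :
    ∫ ω, Y ω ∂P = 0 := by
  obtain ⟨v, hv⟩ := hM Y hY
  have := integral_id_gaussianReal (μ := 0) (v := v)
  rwa [← hv, integral_map (hM.hasGaussianLaw hY).aemeasurable (by fun_prop)] at this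

lemma isGaussianProcess (hM : IsCenteredGaussianSpace M P) {T : Type*}
    {X : T → Ω → ℝ} (hX : ∀ t, X t ∈ M) : IsGaussianProcess X P where
  hasGaussianLaw I := by
    classical
    refine ⟨isGaussian_of_map_eq_gaussianReal fun L => ?_⟩
    have hm : AEMeasurable (fun ω => I.restrict (X · ω)) P :=
      aemeasurable_pi_lambda _ fun i => (hM.hasGaussianLaw (hX i)).aemeasurable
    rw [AEMeasurable.map_map_of_aemeasurable (by fun_prop) hm]
    obtain ⟨v, hv⟩ := hM (∑ i : I, L (Pi.single i 1) • X i)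
      (M.sum_mem fun i _ => M.smul_mem _ (hX i))
    refine ⟨0, v, ?_⟩
    rw [← hv]
    congr 1
    ext ω
    have h : L (I.restrict (X · ω)) = ∑ i : I, X i ω * L (Pi.single i 1) := by
      rw [← ContinuousLinearMap.coe_coe, LinearMap.pi_apply_eq_sum_univ]
      refine Finset.sum_congr rfl fun i _ => ?_
      simp only [Finset.restrict_def, smul_eq_mul]
      congr 2
      ext j
      simp [Pi.single_apply, eq_comm]
    simp only [Function.comp_apply, h, smul_eq_mul, Finset.sum_apply, Pi.smul_apply, mul_comm]

end IsCenteredGaussianSpace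

lemma lintegral_gaussianReal_add (v : NNReal) (hv : v ≠ 0) {F : ℝ → ENNReal}
    (hF : Measurable F) :
    ∫⁻ z, F (z + v) ∂(gaussianReal 0 v)
      = ∫⁻ z, F z * ENNReal.ofReal (Real.exp (z - v / 2)) ∂(gaussianReal 0 v) := by
  have hv' : (v : ℝ) ≠ 0 := by simpa using hv
  rw [← lintegral_map (g := fun z : ℝ => z + v) hF (by fun_prop), gaussianReal_map_add_const,
    gaussianReal_of_var_ne_zero _ hv, gaussianReal_of_var_ne_zero _ hv,
    lintegral_withDensity_eq_lintegral_mul _ (measurable_gaussianPDF _ _) hF,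
    lintegral_withDensity_eq_lintegral_mul _ (measurable_gaussianPDF _ _) (by fun_prop)]
  refine lintegral_congr fun z => ?_
  simp only [Pi.mul_apply, gaussianPDF]
  rw [mul_comm (F z), ← mul_assoc, ← ENNReal.ofReal_mul (gaussianPDFReal_nonneg _ _ _)]
  congr 2
  simp only [gaussianPDFReal]
  rw [mul_assoc _ _ (Real.exp (z - v / 2)), ← Real.exp_add]
  congr 2
  field_simp
  ring

/-- Cameron–Martin formula: shifting a centered Gaussian process `X` by its covariances with a
variable `Z` of its Gaussian space amounts to the change of density `exp (Z - Var Z / 2)`. -/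
lemma cameronMartin {Ω T : Type*} {mΩ : MeasurableSpace Ω} {P : Measure Ω}
    [IsProbabilityMeasure P] {M : Submodule ℝ (Ω → ℝ)} (hM : IsCenteredGaussianSpace M P)
    {X : T → Ω → ℝ} {Z : Ω → ℝ} (hX : ∀ t, X t ∈ M) (hZ : Z ∈ M)
    (hXm : ∀ t, Measurable (X t)) (hZm : Measurable Z) {a : T → ℝ} {s : ℝ}
    (ha : ∀ t, ∫ ω, X t ω * Z ω ∂P = a t) (hs : ∫ ω, Z ω * Z ω ∂P = s)
    {A : Set (T → ℝ)} (hA : MeasurableSet A) :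
    P {ω | (fun t => X t ω + a t) ∈ A}
      = ∫⁻ ω in {ω | (fun t => X t ω) ∈ A}, ENNReal.ofReal (Real.exp (Z ω - s / 2)) ∂P := by
  have hcov : ∀ Y ∈ M, ∀ Y' ∈ M, cov[Y, Y'; P] = ∫ ω, Y ω * Y' ω ∂P := by
    intro Y hY Y' hY'
    rw [covariance_eq_sub (hM.hasGaussianLaw hY).memLp_two (hM.hasGaussianLaw hY').memLp_two,
      hM.integral_eq_zero hY, zero_mul, sub_zero]
    rfl
  have hvar : Var[Z; P] = s := by
    rw [← covariance_self hZm.aemeasurable, hcov Z hZ Z hZ, hs]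
  have hXmeas : Measurable fun ω t => X t ω := measurable_pi_lambda _ hXm
  obtain ⟨v, hv⟩ : ∃ v : NNReal, (v : ℝ) = s := ⟨⟨s, hvar ▸ variance_nonneg _ _⟩, rfl⟩
  have hlaw : P.map Z = gaussianReal 0 v := by
    rw [(hM.hasGaussianLaw hZ).map_eq_gaussianReal, hvar, ← hv, Real.toNNReal_coe]
    congr 1
    exact hM.integral_eq_zero hZ
  by_cases hv0 : v = 0
  · have hZ0 : ∀ᵐ ω ∂P, Z ω = 0 := by
      have : ∀ᵐ z ∂(P.map Z), z = 0 := by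
        rw [hlaw, hv0, gaussianReal_zero_var]
        exact (ae_dirac_iff (measurableSet_singleton _)).2 rfl
      exact ae_of_ae_map hZm.aemeasurable this
    have ha0 : ∀ t, a t = 0 := by
      intro t
      rw [← ha t]
      refine integral_eq_zero_of_ae ?_
      filter_upwards [hZ0] with ω h
      simp [h]
    have hs0 : s = 0 := by rw [← hv, hv0]; rfl
    have hA' : MeasurableSet {ω | (fun t => X t ω) ∈ A} := hXmeas hA
    rw [setLIntegral_congr_fun_ae (g := fun _ => 1) hA']
    · simp [ha0]
    · filter_upwards [hZ0] with ω h _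
      simp [h, hs0]
  have hs0 : s ≠ 0 := by rw [← hv]; simpa using hv0
  have hWm : ∀ t, Measurable fun ω => X t ω - a t / s * Z ω := fun t =>
    (hXm t).sub (hZm.const_mul _)
  have hWM : ∀ t, (fun ω => X t ω - a t / s * Z ω) ∈ M := fun t =>
    M.sub_mem (hX t) (M.smul_mem (a t / s) hZ)
  have hind : IndepFun (fun ω t => X t ω - a t / s * Z ω) Z P := by
    have h1 := IsGaussianProcess.indepFun_of_covariance_eq_zero (P := P)
      (X := fun t ω => X t ω - a t / s * Z ω) (Y := fun (_ : Unit) => Z)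
      (hM.isGaussianProcess (by rintro (t | t); exacts [hWM t, hZ]))
      (fun t => (hWm t).aemeasurable) (fun _ => hZm.aemeasurable) ?_
    · exact h1.comp measurable_id (measurable_pi_apply ())
    · intro t _
      rw [hcov _ (hWM t) _ hZ]
      simp_rw [sub_mul, mul_assoc]
      rw [integral_sub (f := fun ω => X t ω * Z ω) (g := fun ω => a t / s * (Z ω * Z ω))
        ((hM.hasGaussianLaw (hX t)).memLp_two.integrable_mul
          (hM.hasGaussianLaw hZ).memLp_two) (((hM.hasGaussianLaw hZ).memLp_two.integrable_mul
        (hM.hasGaussianLaw hZ).memLp_two).const_mul _), integral_const_mul, ha, hs]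
      field_simp
      ring
  have hWmeas : Measurable fun ω t => X t ω - a t / s * Z ω := measurable_pi_lambda _ hWm
  have hprod := (indepFun_iff_map_prod_eq_prod_map_map hWmeas.aemeasurable hZm.aemeasurable).1 hind
  rw [hlaw] at hprod
  have : IsProbabilityMeasure (P.map fun ω t => X t ω - a t / s * Z ω) :=
    Measure.isProbabilityMeasure_map hWmeas.aemeasurable
  have hφ : Measurable fun q : (T → ℝ) × ℝ => fun t => q.1 t + a t / s * q.2 :=
    measurable_pi_lambda _ fun t =>
      ((measurable_pi_apply t).comp measurable_fst).add (measurable_snd.const_mul _)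
  obtain ⟨F, hFdef⟩ : ∃ F : (T → ℝ) × ℝ → ENNReal, ∀ q, F q =
      A.indicator (fun _ => (1 : ENNReal)) (fun t => q.1 t + a t / s * q.2) := ⟨_, fun _ => rfl⟩
  have hF : Measurable F := by
    rw [funext hFdef]
    exact (measurable_const.indicator hA).comp hφ
  have hFs : Measurable fun q : (T → ℝ) × ℝ => F (q.1, q.2 + v) := by fun_prop
  have hFe : Measurable fun q : (T → ℝ) × ℝ =>
      F q * ENNReal.ofReal (Real.exp (q.2 - v / 2)) := by fun_prop
  have hL : P {ω | (fun t => X t ω + a t) ∈ A}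
      = ∫⁻ ω, F (fun t => X t ω - a t / s * Z ω, Z ω + v) ∂P := by
    have hm : MeasurableSet {ω | (fun t => X t ω + a t) ∈ A} :=
      (measurable_pi_lambda (fun ω t => X t ω + a t) fun t => (hXm t).add_const (a t)) hA
    rw [← lintegral_indicator_one hm]
    refine lintegral_congr fun ω => ?_
    have : (fun t => X t ω - a t / s * Z ω + a t / s * (Z ω + v)) = fun t => X t ω + a t := by
      ext t
      rw [hv]
      field_simp
      ring
    simp only [hFdef, this]
    rfl
  have hA' : MeasurableSet {ω | (fun t => X t ω) ∈ A} := hXmeas hA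
  have hR : ∫⁻ ω in {ω | (fun t => X t ω) ∈ A}, ENNReal.ofReal (Real.exp (Z ω - s / 2)) ∂P
      = ∫⁻ ω, F (fun t => X t ω - a t / s * Z ω, Z ω) *
        ENNReal.ofReal (Real.exp (Z ω - v / 2)) ∂P := by
    rw [← lintegral_indicator hA']
    refine lintegral_congr fun ω => ?_
    simp only [hFdef, sub_add_cancel, hv]
    by_cases h : (fun t => X t ω) ∈ A
    · rw [Set.indicator_of_mem h, Set.indicator_of_mem (by exact h), one_mul]
    · rw [Set.indicator_of_notMem h, Set.indicator_of_notMem (by exact h), zero_mul]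
  rw [hL, hR, ← lintegral_map hFs (hWmeas.prodMk hZm), ← lintegral_map hFe (hWmeas.prodMk hZm),
    hprod, lintegral_prod _ hFs.aemeasurable, lintegral_prod _ hFe.aemeasurable]
  refine lintegral_congr fun w => ?_
  exact lintegral_gaussianReal_add v hv0 (hF.comp measurable_prodMk_left)

end CameronMartin

section ConcaveMajorant

open Topology

namespace GeneratesMeasure1

variable {f : ℝ → ℝ} {ν : Measure ℝ}

lemma integral_mul_eq (hν : GeneratesMeasure1 f ν) {g : ℝ → ℝ}
    (hg : IntegrableOn g (Icc 0 1)) :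
    ∫ y in Icc (0:ℝ) 1, g y * f y
      = f 0 * (∫ y in Icc (0:ℝ) 1, g y) - ∫ x in Ioc (0:ℝ) 1, (∫ y in Icc x 1, g y) ∂ν := by
  obtain ⟨-, -, hfin, -, hgen⟩ := hν
  have hf : ∀ y ∈ Icc (0:ℝ) 1, f y = f 0 - ν.real (Ioc 0 y) := by
    intro y hy
    have := hgen 0 y le_rfl hy.1 hy.2
    rw [Measure.real, this]
    ring
  have hint : Integrable (fun p : ℝ × ℝ => {q : ℝ × ℝ | q.2 ≤ q.1}.indicator (fun q => g q.1) p)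
      ((volume.restrict (Icc (0:ℝ) 1)).prod (ν.restrict (Ioc 0 1))) :=
    (Integrable.comp_fst hg _).indicator (measurableSet_le measurable_snd measurable_fst)
  have hin : ∀ y ∈ Icc (0:ℝ) 1,
      ∫ x in Ioc (0:ℝ) 1, {q : ℝ × ℝ | q.2 ≤ q.1}.indicator (fun q => g q.1) (y, x) ∂ν
        = g y * ν.real (Ioc 0 y) := by
    intro y hy
    have : ∀ x, {q : ℝ × ℝ | q.2 ≤ q.1}.indicator (fun q => g q.1) (y, x)
        = (Iic y).indicator (fun _ => g y) x := fun x => rfl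
    simp_rw [this]
    rw [setIntegral_indicator measurableSet_Iic, Ioc_inter_Iic, min_eq_right hy.2,
      setIntegral_const, smul_eq_mul, mul_comm]
  have hout : ∀ x ∈ Ioc (0:ℝ) 1,
      ∫ y in Icc (0:ℝ) 1, {q : ℝ × ℝ | q.2 ≤ q.1}.indicator (fun q => g q.1) (y, x)
        = ∫ y in Icc x 1, g y := by
    intro x hx
    have : ∀ y, {q : ℝ × ℝ | q.2 ≤ q.1}.indicator (fun q => g q.1) (y, x)
        = (Ici x).indicator g y := fun y => rfl
    simp_rw [this]
    rw [setIntegral_indicator measurableSet_Ici]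
    congr 2
    ext y
    simp only [mem_inter_iff, mem_Icc, mem_Ici]
    constructor
    · rintro ⟨⟨_, h⟩, h'⟩; exact ⟨h', h⟩
    · rintro ⟨h', h⟩; exact ⟨⟨hx.1.le.trans h', h⟩, h'⟩
  have hswap := integral_integral_swap (f := fun y x =>
    {q : ℝ × ℝ | q.2 ≤ q.1}.indicator (fun q => g q.1) (y, x)) hint
  have hleft : IntegrableOn (fun y => g y * ν.real (Ioc 0 y)) (Icc 0 1) :=
    IntegrableOn.congr_fun (Integrable.integral_prod_left hint) hin measurableSet_Icc
  rw [setIntegral_congr_fun measurableSet_Icc hin, setIntegral_congr_fun measurableSet_Ioc hout]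
    at hswap
  rw [← hswap, ← integral_const_mul, ← integral_sub (hg.const_mul _) hleft]
  refine setIntegral_congr_fun measurableSet_Icc fun y hy => ?_
  simp only [hf y hy]
  ring

lemma ae_mem (hν : GeneratesMeasure1 f ν) : ∀ᵐ x ∂ν, x ∈ Icc (0:ℝ) 1 := hν.2.2.2.1

lemma setIntegral_Ioc_eq (hν : GeneratesMeasure1 f ν) {g : ℝ → ℝ} (hg : g 0 = 0) :
    ∫ x in Ioc (0:ℝ) 1, g x ∂ν = ∫ x, g x ∂ν := by
  refine setIntegral_eq_integral_of_ae_compl_eq_zero ?_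
  filter_upwards [hν.ae_mem] with x hx hx'
  rcases hx.1.eq_or_lt with h | h
  · rw [← h, hg]
  · exact absurd ⟨h, hx.2⟩ hx'

lemma integrable_of_continuous (hν : GeneratesMeasure1 f ν) {g : ℝ → ℝ} (hg : Continuous g) :
    Integrable g ν := by
  have := hν.2.2.1
  rw [← Measure.restrict_eq_self_of_ae_mem hν.ae_mem]
  exact hg.continuousOn.integrableOn_compact isCompact_Icc

lemma integrableOn (hν : GeneratesMeasure1 f ν) : IntegrableOn f (Icc 0 1) :=
  AntitoneOn.integrableOn_isCompact isCompact_Icc fun x hx y hy h =>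
    neg_le_neg_iff.1 (hν.2.1 x hx y hy h)

lemma measure_Ioo_eq_zero (hν : GeneratesMeasure1 f ν) {g : ℝ → ℝ} (hg : Continuous g)
    (hg0 : ∀ x ∈ Icc (0:ℝ) 1, 0 ≤ g x) (hint : ∫ x, g x ∂ν ≤ 0) {a b : ℝ}
    (hpos : ∀ x ∈ Ioo a b, 0 < g x) : ν (Ioo a b) = 0 := by
  have h0 : 0 ≤ᵐ[ν] g := hν.ae_mem.mono hg0
  have h1 := (integral_eq_zero_iff_of_nonneg_ae h0 (hν.integrable_of_continuous hg)).1
    (le_antisymm hint (integral_nonneg_of_ae h0))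
  refine measure_mono_null (fun x hx => ?_) (ae_iff.1 h1)
  exact (hpos x hx).ne'

end GeneratesMeasure1

namespace IsH10

variable {h t td : ℝ → ℝ} {ν : Measure ℝ}

lemma eq_integral_kernel (ht : IsH10 t td) (hν : GeneratesMeasure1 td ν) {s : ℝ}
    (hs : s ∈ Icc (0:ℝ) 1) : t s = ∫ x, (min s x - s * x) ∂ν := by
  have key : ∀ s ∈ Icc (0:ℝ) 1, t s = td 0 * s - ∫ x in Ioc (0:ℝ) 1, max (s - x) 0 ∂ν := by
    intro s hs
    have h1 := hν.integral_mul_eq (g := (Iic s).indicator fun _ => 1)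
      ((integrable_const (1:ℝ)).indicator measurableSet_Iic)
    have hI : Icc (0:ℝ) 1 ∩ Iic s = Icc 0 s := by
      ext y; simp only [mem_inter_iff, mem_Icc, mem_Iic]
      exact ⟨fun h => ⟨h.1.1, h.2⟩, fun h => ⟨⟨h.1, h.2.trans hs.2⟩, h.2⟩⟩
    have h2 : ∀ y, (Iic s).indicator (fun _ => (1:ℝ)) y * td y = (Iic s).indicator td y := by
      intro y; by_cases h : y ∈ Iic s <;> simp [h]
    simp_rw [h2] at h1
    rw [setIntegral_indicator measurableSet_Iic, setIntegral_indicator measurableSet_Iic, hI,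
      ← ht.repr s hs] at h1
    rw [h1]
    congr 2
    · simp [hs.1]
    · refine funext fun x => ?_
      rw [setIntegral_indicator measurableSet_Iic]
      have : Icc x 1 ∩ Iic s = Icc x s := by
        ext y; simp only [mem_inter_iff, mem_Icc, mem_Iic]
        exact ⟨fun h => ⟨h.1.1, h.2⟩, fun h => ⟨⟨h.1, h.2.trans hs.2⟩, h.2⟩⟩
      rw [this]
      simp [Measure.real, ENNReal.toReal_ofReal']
  have h1 := key 1 ⟨zero_le_one, le_rfl⟩
  rw [ht.one] at h1
  have e1 : td 0 = ∫ x in Ioc (0:ℝ) 1, max (1 - x) 0 ∂ν := by linarith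
  rw [key s hs, e1, ← integral_mul_const, ← integral_sub, ← hν.setIntegral_Ioc_eq]
  · refine setIntegral_congr_fun measurableSet_Ioc fun x hx => ?_
    rw [max_eq_left (by linarith [hx.2])]
    rcases le_total s x with h | h
    · rw [min_eq_left h, max_eq_right (by linarith)]; ring
    · rw [min_eq_right h, max_eq_left (by linarith)]; ring
  · simp [hs.1]
  · exact (hν.integrable_of_continuous (by fun_prop)).restrict
  · exact (hν.integrable_of_continuous (by fun_prop)).restrict

lemma continuousOn_of_integrableOn (ht : IsH10 t td) (htd : IntegrableOn td (Icc 0 1)) :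
    ContinuousOn t (Icc 0 1) :=
  (intervalIntegral.continuousOn_primitive_Icc htd).congr fun s hs => ht.repr s hs

lemma integral_eq_norm1_sq (ht : IsH10 t td) (hν : GeneratesMeasure1 td ν) :
    ∫ x, t x ∂ν = norm1 td ^ 2 := by
  rw [norm1, Real.sq_sqrt (integral_nonneg fun x => sq_nonneg _)]
  have h1 := hν.integral_mul_eq hν.integrableOn
  rw [← ht.repr 1 ⟨zero_le_one, le_rfl⟩, ht.one, mul_zero, zero_sub, ← integral_neg] at h1
  simp_rw [sq]
  rw [h1, ← hν.setIntegral_Ioc_eq ht.zero]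
  refine setIntegral_congr_fun measurableSet_Ioc fun x hx => ?_
  have hd : ∫ y in Icc 0 x, td y = t x := (ht.repr x ⟨hx.1.le, hx.2⟩).symm
  have h1 : ∫ y in Icc 0 1, td y = 0 := by rw [← ht.repr 1 ⟨zero_le_one, le_rfl⟩, ht.one]
  have hadd : ∫ y in Icc 0 1, td y = (∫ y in Icc 0 x, td y) + ∫ y in Icc x 1, td y := by
    rw [integral_Icc_eq_integral_Ioc (x := x), ← setIntegral_union _ measurableSet_Ioc,
      Icc_union_Ioc_eq_Icc hx.1.le hx.2]
    · exact hν.integrableOn.mono_set (Icc_subset_Icc_right hx.2)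
    · exact hν.integrableOn.mono_set (Ioc_subset_Icc_self.trans (Icc_subset_Icc_left hx.1.le))
    · exact Set.disjoint_left.2 fun y hy hy' => absurd hy.2 (not_le.2 hy'.1)
  linarith

/-- The derivative datum of `IsH10` need not be measurable, hence the cut-off point `c`. -/
lemma exists_integrableOn_and_eq_zero {hd : ℝ → ℝ} (hh : IsH10 h hd) :
    ∃ c ∈ Icc (0:ℝ) 1, IntegrableOn hd (Icc 0 c) ∧ ∀ s ∈ Ioc c 1, h s = 0 := by
  set S := {s ∈ Icc (0:ℝ) 1 | AEStronglyMeasurable hd (volume.restrict (Icc 0 s))} with hS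
  have h0 : (0:ℝ) ∈ S := by
    refine ⟨⟨le_rfl, zero_le_one⟩, ?_⟩
    rw [Icc_self, Measure.restrict_eq_zero.2 (by simp)]
    exact aestronglyMeasurable_zero_measure _
  have hbdd : BddAbove S := ⟨1, fun s hs => hs.1.2⟩
  have hc0 : 0 ≤ sSup S := le_csSup hbdd h0
  have hc1 : sSup S ≤ 1 := csSup_le ⟨0, h0⟩ fun s hs => hs.1.2
  have hmeas : AEStronglyMeasurable hd (volume.restrict (Icc 0 (sSup S))) := by
    rw [← restrict_Ico_eq_restrict_Icc]
    obtain ⟨u, -, hu, huS⟩ := exists_seq_tendsto_sSup ⟨0, h0⟩ hbdd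
    refine AEStronglyMeasurable.mono_measure
      (aestronglyMeasurable_iUnion_iff.2 fun n => (huS n).2) (Measure.restrict_mono ?_ le_rfl)
    intro y hy
    obtain ⟨n, hn⟩ := (hu.eventually (lt_mem_nhds hy.2)).exists
    exact mem_iUnion.2 ⟨n, hy.1, hn.le⟩
  refine ⟨sSup S, ⟨hc0, hc1⟩, ?_, fun s hs => ?_⟩
  · have : MemLp hd 2 (volume.restrict (Icc 0 (sSup S))) :=
      (memLp_two_iff_integrable_sq hmeas).2 (hh.sq_int.mono_set (Icc_subset_Icc_right hc1))
    exact this.integrable one_le_two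
  · have hsI : s ∈ Icc (0:ℝ) 1 := ⟨hc0.trans hs.1.le, hs.2⟩
    rw [hh.repr s hsI]
    exact integral_non_aestronglyMeasurable fun hm =>
      absurd (le_csSup hbdd ⟨hsI, hm⟩) (not_le.2 hs.1)

lemma eventually_lt {hd : ℝ → ℝ} (hh : IsH10 h hd) {x m : ℝ} (hx : x ∈ Icc (0:ℝ) 1)
    (hm : h x < m) (hm0 : 0 < m) : ∀ᶠ y in 𝓝[Icc 0 1] x, h y < m := by
  obtain ⟨c, hc, hint, hz⟩ := hh.exists_integrableOn_and_eq_zero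
  rcases lt_or_ge c x with hcx | hcx
  · filter_upwards [mem_nhdsWithin_of_mem_nhds (lt_mem_nhds hcx), self_mem_nhdsWithin]
      with y hy hy'
    rwa [hz y ⟨hy, hy'.2⟩]
  · have hcont : ContinuousOn (fun y => ∫ z in Icc 0 (min y c), hd z) (Icc 0 1) :=
      (intervalIntegral.continuousOn_primitive_Icc hint).comp (by fun_prop)
        fun y hy => ⟨le_min hy.1 hc.1, min_le_right _ _⟩
    have hlt : ∀ᶠ y in 𝓝[Icc 0 1] x, (∫ z in Icc 0 (min y c), hd z) < m := by
      refine (hcont x hx).eventually_lt_const ?_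
      simp only [min_eq_left hcx]
      rwa [← hh.repr x hx]
    filter_upwards [hlt, self_mem_nhdsWithin] with y hy hy'
    rcases le_or_gt y c with hyc | hyc
    · rw [min_eq_left hyc] at hy
      rwa [hh.repr y hy']
    · rwa [hz y ⟨hyc, hy'.2⟩]

end IsH10

lemma ConcaveOn.le_chord_of_notMem {t : ℝ → ℝ} (ht : ConcaveOn ℝ (Icc (0:ℝ) 1) t) {a b x : ℝ}
    (ha : a ∈ Icc (0:ℝ) 1) (hb : b ∈ Icc (0:ℝ) 1) (hab : a < b) (hx : x ∈ Icc (0:ℝ) 1)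
    (hxab : x ∉ Icc a b) : t x ≤ t a + (t b - t a) / (b - a) * (x - a) := by
  have hba : 0 < b - a := sub_pos.2 hab
  rcases lt_or_ge x a with h | h
  · have := ht.slope_anti_adjacent hx hb h hab
    rw [le_div_iff₀ (sub_pos.2 h)] at this
    linarith
  · have hbx : b < x := not_le.1 fun h' => hxab ⟨h, h'⟩
    have := ht.slope_anti_adjacent ha hx hab hbx
    rw [div_le_iff₀ (sub_pos.2 hbx)] at this
    have e : (t b - t a) / (b - a) * (b - a) = t b - t a := div_mul_cancel₀ _ hba.ne'
    linarith

/-- Where the smallest concave majorant lies above `m` and the function below, the majorant is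
below its chords. -/
lemma IsSCM.le_chord {h t : ℝ → ℝ} (hscm : IsSCM h t) {a b m : ℝ}
    (ha : a ∈ Icc (0:ℝ) 1) (hb : b ∈ Icc (0:ℝ) 1) (hab : a < b)
    (hh : ∀ x ∈ Icc a b, h x ≤ m) (hta : m ≤ t a) (htb : m ≤ t b) {x : ℝ}
    (hx : x ∈ Icc a b) : t x ≤ t a + (t b - t a) / (b - a) * (x - a) := by
  have hba : 0 < b - a := sub_pos.2 hab
  obtain ⟨hconc, hmaj, hmin⟩ := hscm
  set q := (t b - t a) / (b - a) with hq
  have e : q * (b - a) = t b - t a := div_mul_cancel₀ _ hba.ne'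
  have haff : ConcaveOn ℝ (Icc (0:ℝ) 1) fun x => t a + q * (x - a) := by
    refine ⟨convex_Icc _ _, fun x _ y _ c d _ _ hcd => le_of_eq ?_⟩
    simp only [smul_eq_mul]
    have : d = 1 - c := by linarith
    rw [this]; ring
  refine (hmin _ (hconc.inf haff) (fun y hy => ?_) x
    ⟨ha.1.trans hx.1, hx.2.trans hb.2⟩).trans inf_le_right
  refine le_inf (hmaj y hy) ?_
  by_cases hyab : y ∈ Icc a b
  · refine (hh y hyab).trans ?_
    rcases le_total 0 q with h0 | h0
    · nlinarith [hyab.1]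
    · nlinarith [hyab.2]
  · exact (hmaj y hy).trans (hconc.le_chord_of_notMem ha hb hab hy hyab)

/-- The measure generated by the derivative of the smallest concave majorant is carried by the
contact set. -/
lemma IsSCM.ae_eq {h hd t td : ℝ → ℝ} {ν : Measure ℝ} (hscm : IsSCM h t) (hh : IsH10 h hd)
    (ht : IsH10 t td) (hν : GeneratesMeasure1 td ν) : ∀ᵐ x ∂ν, h x = t x := by
  have hcont := ht.continuousOn_of_integrableOn hν.integrableOn
  suffices hnull : ν {x | x ∈ Ioo (0:ℝ) 1 ∧ h x ≠ t x} = 0 by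
    filter_upwards [hν.ae_mem, measure_eq_zero_iff_ae_notMem.1 hnull] with x hx hx'
    by_contra hne
    rcases hx.1.eq_or_lt with h0 | h0
    · exact hne (by rw [← h0, hh.zero, ht.zero])
    rcases hx.2.eq_or_lt with h1 | h1
    · exact hne (by rw [h1, hh.one, ht.one])
    exact hx' ⟨⟨h0, h1⟩, hne⟩
  refine measure_null_of_locally_null _ fun x hx => ?_
  obtain ⟨hx01, hne⟩ := hx
  have hxI : x ∈ Icc (0:ℝ) 1 := Ioo_subset_Icc_self hx01
  have hlt : h x < t x := lt_of_le_of_ne (hscm.2.1 x hxI) hne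
  rcases lt_or_ge 0 (t x) with hpos | hneg
  · obtain ⟨m, hm, hmt⟩ := exists_between (max_lt hlt hpos)
    have hnhds : 𝓝[Icc 0 1] x = 𝓝 x := nhdsWithin_eq_nhds.2 (Icc_mem_nhds hx01.1 hx01.2)
    have ev1 := hh.eventually_lt hxI ((le_max_left _ _).trans_lt hm) ((le_max_right _ _).trans_lt hm)
    have ev2 := (hcont x hxI).eventually (lt_mem_nhds hmt)
    rw [hnhds] at ev1 ev2
    obtain ⟨ε, hε, hball⟩ := Metric.nhds_basis_closedBall.eventually_iff.1
      (ev1.and (ev2.and (Icc_mem_nhds hx01.1 hx01.2)))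
    rw [Real.closedBall_eq_Icc] at hball
    have hl := hball (left_mem_Icc.2 (by linarith))
    have hr := hball (right_mem_Icc.2 (by linarith))
    have hchord := hscm.le_chord hl.2.2 hr.2.2 (by linarith)
      (fun y hy => (hball hy).1.le) hl.2.1.le hr.2.1.le
      (x := x) ⟨by linarith, by linarith⟩
    refine ⟨Ioo (x - ε) (x + ε),
      mem_nhdsWithin_of_mem_nhds (Ioo_mem_nhds (by linarith) (by linarith)), ?_⟩
    refine hν.measure_Ioo_eq_zero
      (g := fun y => 2 * (min x y - x * y) - (min (x - ε) y - (x - ε) * y)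
        - (min (x + ε) y - (x + ε) * y)) (by fun_prop) (fun y hy => ?_) ?_ (fun y hy => ?_)
    · have h1 := min_le_left (x - ε) y
      have h2 := min_le_right (x - ε) y
      have h3 := min_le_left (x + ε) y
      have h4 := min_le_right (x + ε) y
      rcases le_total x y with h | h
      · rw [min_eq_left h]; linarith
      · rw [min_eq_right h]; linarith
    · rw [integral_sub (hν.integrable_of_continuous (by fun_prop))
          (hν.integrable_of_continuous (by fun_prop)),
        integral_sub (hν.integrable_of_continuous (by fun_prop))
          (hν.integrable_of_continuous (by fun_prop)), integral_const_mul,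
        ← ht.eq_integral_kernel hν hxI, ← ht.eq_integral_kernel hν hl.2.2,
        ← ht.eq_integral_kernel hν hr.2.2]
      have e : (t (x + ε) - t (x - ε)) / (x + ε - (x - ε)) * (x - (x - ε))
          = (t (x + ε) - t (x - ε)) / 2 := by
        have := hε.ne'
        rw [show x + ε - (x - ε) = 2 * ε by ring, show x - (x - ε) = ε by ring]
        field_simp
      rw [e] at hchord
      linarith
    · rw [min_eq_left hy.1.le, min_eq_right hy.2.le]
      rcases le_total x y with h | h
      · rw [min_eq_left h]; linarith [hy.2]
      · rw [min_eq_right h]; linarith [hy.1]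
  · refine ⟨Ioo 0 1, mem_nhdsWithin_of_mem_nhds (Ioo_mem_nhds hx01.1 hx01.2), ?_⟩
    have hpos : ∀ y ∈ Icc (0:ℝ) 1, 0 ≤ min x y - x * y := fun y hy => by
      rcases le_total x y with h | h
      · rw [min_eq_left h]; nlinarith [hx01.1, hy.2]
      · rw [min_eq_right h]; nlinarith [hx01.2, hy.1]
    refine hν.measure_Ioo_eq_zero (g := fun y => min x y - x * y) (by fun_prop) hpos
      (by rwa [← ht.eq_integral_kernel hν hxI]) fun y hy => ?_
    rcases le_total x y with h | h
    · simp only [min_eq_left h]; nlinarith [hx01.1, hy.2]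
    · simp only [min_eq_right h]; nlinarith [hx01.2, hy.1]

end ConcaveMajorant

section BrownianPillow

open ProbabilityTheory Topology

lemma exists_measurable_modification {Ω T : Type*} [TopologicalSpace T]
    [TopologicalSpace.SeparableSpace T] [FirstCountableTopology T] {mΩ : MeasurableSpace Ω}
    {P : Measure Ω} {X : T → Ω → ℝ} (hcont : ∀ ω, Continuous fun t => X t ω)
    (hX : ∀ t, AEMeasurable (X t) P) :
    ∃ Y : T → Ω → ℝ, (∀ t, Measurable (Y t)) ∧ (∀ ω, Continuous fun t => Y t ω) ∧
      ∀ᵐ ω ∂P, ∀ t, Y t ω = X t ω := by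
  obtain ⟨D, hDc, hDd⟩ := TopologicalSpace.exists_countable_dense T
  have hae : ∀ᵐ ω ∂P, ∀ d ∈ D, X d ω = (hX d).mk _ ω :=
    (ae_ball_iff hDc).2 fun d _ => (hX d).ae_eq_mk
  set N := {ω | ¬ ∀ d ∈ D, X d ω = (hX d).mk _ ω}
  set G := (toMeasurable P N)ᶜ
  have hGm : MeasurableSet G := (measurableSet_toMeasurable P N).compl
  have hGD : ∀ ω ∈ G, ∀ d ∈ D, X d ω = (hX d).mk _ ω := fun ω hω => by
    by_contra h
    exact hω (subset_toMeasurable P N h)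
  refine ⟨fun t => G.indicator (X t), fun t => ?_, fun ω => ?_, ?_⟩
  · obtain ⟨d, hd, hdt⟩ := mem_closure_iff_seq_limit.1 (hDd t)
    refine measurable_of_tendsto_metrizable
      (fun n => ((hX (d n)).measurable_mk.indicator hGm)) (tendsto_pi_nhds.2 fun ω => ?_)
    by_cases hω : ω ∈ G
    · simp only [indicator_of_mem hω]
      refine (((hcont ω).tendsto t).comp hdt).congr fun n => hGD ω hω _ (hd n)
    · simp only [indicator_of_notMem hω, tendsto_const_nhds]
  · by_cases hω : ω ∈ G
    · simpa only [indicator_of_mem hω] using hcont ω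
    · simpa only [indicator_of_notMem hω] using continuous_const
  · have h0 : P (toMeasurable P N) = 0 := by rw [measure_toMeasurable]; exact hae
    filter_upwards [measure_eq_zero_iff_ae_notMem.1 h0] with ω hω t
    exact indicator_of_mem hω _

lemma exists_countable_forall_le_iff {T : Type*} [PseudoMetricSpace T] [SecondCountableTopology T]
    (K : Set T) (g : T → ℝ) :
    ∃ D ⊆ K, D.Countable ∧ ∀ f : T → ℝ, ContinuousOn f K →
      ((∀ p ∈ K, f p ≤ g p) ↔ ∀ p ∈ D, f p ≤ g p) := by
  obtain ⟨c, hcS, hc, hScl⟩ := (TopologicalSpace.IsSeparable.of_separableSpace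
    ((fun p => (p, g p)) '' K)).exists_countable_dense_subset
  have hfst : ∀ q ∈ c, q.1 ∈ K ∧ q.2 = g q.1 := fun q hq => by
    obtain ⟨p, hp, rfl⟩ := hcS hq
    exact ⟨hp, rfl⟩
  have hDK : Prod.fst '' c ⊆ K := by
    rintro _ ⟨q, hq, rfl⟩
    exact (hfst q hq).1
  refine ⟨Prod.fst '' c, hDK, hc.image _, fun f hf =>
    ⟨fun h p hp => h p (hDK hp), fun h p hp => ?_⟩⟩
  obtain ⟨q, hq, hqp⟩ := mem_closure_iff_seq_limit.1 (hScl (mem_image_of_mem _ hp))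
  have h1 : Tendsto (fun n => (q n).1) atTop (𝓝[K] p) :=
    tendsto_nhdsWithin_iff.2 ⟨(continuous_fst.tendsto _).comp hqp,
      Eventually.of_forall fun n => (hfst _ (hq n)).1⟩
  refine le_of_tendsto_of_tendsto' ((hf p hp).tendsto.comp h1)
    ((continuous_snd.tendsto _).comp hqp) fun n => ?_
  simp only [Function.comp_apply, (hfst _ (hq n)).2]
  exact h _ (mem_image_of_mem _ (hq n))

lemma measurableSet_forall_le {Ω T : Type*} [PseudoMetricSpace T] [SecondCountableTopology T]
    {mΩ : MeasurableSpace Ω} {X : T → Ω → ℝ} {K : Set T} (hX : ∀ t, Measurable (X t))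
    (hcont : ∀ ω, ContinuousOn (fun t => X t ω) K) (g : T → ℝ) :
    MeasurableSet {ω | ∀ t ∈ K, X t ω ≤ g t} := by
  obtain ⟨D, -, hDc, hD⟩ := exists_countable_forall_le_iff K g
  simp only [hD _ (hcont _), ofPred_forall]
  exact MeasurableSet.biInter hDc fun t _ => measurableSet_le (hX t) measurable_const

section Integral

variable {Ω T : Type*} [MeasurableSpace T] {X : T → Ω → ℝ} {μ : Measure T} [IsFiniteMeasure μ]

lemma integral_comp_simpleFunc_mem_span (φ : SimpleFunc T T) :
    (fun ω => ∫ q, X (φ q) ω ∂μ) ∈ Submodule.span ℝ (range X) := by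
  have h : (fun ω => ∫ q, X (φ q) ω ∂μ)
      = ∑ y ∈ φ.range, μ.real (φ ⁻¹' {y}) • X y := by
    ext ω
    have h1 : ∀ q, X (φ q) ω = ∑ y ∈ φ.range, (φ ⁻¹' {y}).indicator (fun _ => X y ω) q := by
      intro q
      rw [Finset.sum_eq_single_of_mem (φ q) (φ.mem_range_self q)]
      · simp
      · intro b _ hb
        exact indicator_of_notMem (fun h => hb h.symm) _
    simp_rw [h1]
    rw [integral_finsetSum _ fun y _ => (integrable_const _).indicator (φ.measurableSet_fiber y)]
    simp [integral_indicator_const _ (φ.measurableSet_fiber _)]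
  rw [h]
  exact Submodule.sum_mem _ fun y _ =>
    Submodule.smul_mem _ _ (Submodule.subset_span (mem_range_self y))

lemma integral_mem_seqLimits [PseudoEMetricSpace T] [SecondCountableTopology T] [BorelSpace T]
    {K : Set T} (hK : IsCompact K) (hne : K.Nonempty)
    (hcont : ∀ ω, Continuous fun t => X t ω) (hμ : ∀ᵐ t ∂μ, t ∈ K) :
    (fun ω => ∫ t, X t ω ∂μ) ∈ seqLimits (Submodule.span ℝ (range X)) := by
  obtain ⟨y₀, h₀⟩ := hne
  refine ⟨fun n ω => ∫ t, X (SimpleFunc.approxOn id measurable_id K y₀ h₀ n t) ω ∂μ,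
    fun n => integral_comp_simpleFunc_mem_span _, fun ω => ?_⟩
  obtain ⟨C, hC⟩ := hK.exists_bound_of_continuousOn (hcont ω).continuousOn
  refine tendsto_integral_of_dominated_convergence (fun _ => C) (fun n => ?_)
    (integrable_const _) (fun n => ?_) ?_
  · exact ((hcont ω).measurable.comp (SimpleFunc.measurable _)).aestronglyMeasurable
  · exact Eventually.of_forall fun t => hC _ (SimpleFunc.approxOn_mem _ _ _ _)
  · filter_upwards [hμ] with t ht
    exact ((hcont ω).tendsto t).comp
      (SimpleFunc.tendsto_approxOn measurable_id h₀ (subset_closure ht))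

lemma integral_mul_integral_comm {mΩ : MeasurableSpace Ω} {P : Measure Ω} [IsProbabilityMeasure P]
    (hX : Measurable (fun p : Ω × T => X p.2 p.1)) {C : ℝ}
    (hX2 : ∀ᵐ t ∂μ, MemLp (X t) 2 P ∧ ∫ ω, X t ω * X t ω ∂P ≤ C) {W : Ω → ℝ}
    (hW : MemLp W 2 P) :
    ∫ ω, W ω * ∫ t, X t ω ∂μ ∂P = ∫ t, ∫ ω, W ω * X t ω ∂P ∂μ := by
  have hXL : MemLp (fun p : Ω × T => X p.2 p.1) 2 (P.prod μ) := by
    have hsq : Measurable fun p : Ω × T => X p.2 p.1 ^ 2 := hX.pow_const 2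
    rw [memLp_two_iff_integrable_sq hX.aestronglyMeasurable,
      integrable_prod_iff' hsq.aestronglyMeasurable]
    refine ⟨hX2.mono fun t ht => ht.1.integrable_sq, ?_⟩
    refine Integrable.of_bound
      (hsq.norm.comp measurable_swap).aestronglyMeasurable.integral_prod_right' C ?_
    filter_upwards [hX2] with t ht
    rw [Real.norm_of_nonneg (integral_nonneg fun _ => norm_nonneg _)]
    simpa only [norm_pow, Real.norm_eq_abs, sq_abs, ← sq] using ht.2
  have hWL : MemLp (fun p : Ω × T => W p.1) 2 (P.prod μ) := hW.comp_fst μ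
  simp_rw [← integral_const_mul]
  exact integral_integral_swap (hWL.integrable_mul hXL)

end Integral

lemma isCompact_unitSq : IsCompact unitSq := isCompact_Icc.prod isCompact_Icc

lemma unitSq_nonempty : unitSq.Nonempty := ⟨(0, 0), by simp [unitSq]⟩

namespace GeneratesMeasure1

variable {f₁ f₂ : ℝ → ℝ} {ν₁ ν₂ : Measure ℝ}

lemma ae_prod_fst (hν₂ : GeneratesMeasure1 f₂ ν₂) {p : ℝ → Prop} (hp : ∀ᵐ x ∂ν₁, p x) :
    ∀ᵐ q ∂(ν₁.prod ν₂), p q.1 :=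
  have := hν₂.2.2.1
  Measure.quasiMeasurePreserving_fst.ae hp

lemma ae_prod_snd (hν₂ : GeneratesMeasure1 f₂ ν₂) {p : ℝ → Prop} (hp : ∀ᵐ x ∂ν₂, p x) :
    ∀ᵐ q ∂(ν₁.prod ν₂), p q.2 :=
  have := hν₂.2.2.1
  Measure.quasiMeasurePreserving_snd.ae hp

lemma ae_mem_unitSq (hν₁ : GeneratesMeasure1 f₁ ν₁) (hν₂ : GeneratesMeasure1 f₂ ν₂) :
    ∀ᵐ q ∂(ν₁.prod ν₂), q ∈ unitSq := by
  filter_upwards [hν₂.ae_prod_fst hν₁.ae_mem, hν₂.ae_prod_snd hν₂.ae_mem] with q h1 h2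
  exact ⟨h1, h2⟩

end GeneratesMeasure1

namespace IsBrownianPillow

variable {Ω : Type*} [MeasureSpace Ω] {B B' : ℝ × ℝ → Ω → ℝ}

protected lemma aemeasurable (hB : IsBrownianPillow B) (p : ℝ × ℝ) : AEMeasurable (B p) ℙ := by
  obtain ⟨v, hv⟩ := hB.2.1 1 (fun _ => 1) (fun _ => p)
  simp only [Finset.univ_unique, one_mul, Finset.sum_const, Finset.card_singleton, one_smul] at hv
  refine AEMeasurable.of_map_ne_zero ?_
  have : (fun ω => B p ω) = B p := rfl
  rw [this] at hv
  rw [hv]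
  exact IsProbabilityMeasure.ne_zero _

protected lemma congr (hB : IsBrownianPillow B) (hcont : ∀ ω, Continuous fun p => B' p ω)
    (hae : ∀ᵐ ω, ∀ p, B' p ω = B p ω) : IsBrownianPillow B' := by
  refine ⟨hcont, fun n c pts => ?_, fun p hp q hq => ?_⟩
  · obtain ⟨v, hv⟩ := hB.2.1 n c pts
    refine ⟨v, hv ▸ Measure.map_congr ?_⟩
    filter_upwards [hae] with ω hω
    simp only [hω]
  · rw [← hB.2.2 p hp q hq]
    refine integral_congr_ae ?_
    filter_upwards [hae] with ω hω
    simp only [hω]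

lemma isCenteredGaussianSpace (hB : IsBrownianPillow B) :
    IsCenteredGaussianSpace (Submodule.span ℝ (range B)) ℙ := by
  intro Y hY
  obtain ⟨c, rfl⟩ := Finsupp.mem_span_range_iff_exists_finsupp.1 hY
  obtain ⟨v, hv⟩ := hB.2.1 c.support.card (fun i => c (c.support.equivFin.symm i))
    (fun i => c.support.equivFin.symm i)
  refine ⟨v, ?_⟩
  rw [← hv]
  congr 1
  ext ω
  rw [Finsupp.sum, Finset.sum_apply, ← Finset.sum_coe_sort,
    ← Equiv.sum_comp c.support.equivFin.symm]
  simp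

variable {t₁ t₁d t₂ t₂d : ℝ → ℝ} {ν₁ ν₂ : Measure ℝ}

lemma measurable_uncurry (hB : IsBrownianPillow B) (hBm : ∀ p, Measurable (B p)) :
    Measurable fun p : Ω × (ℝ × ℝ) => B p.2 p.1 :=
  (measurable_uncurry_of_continuous_of_measurable (u := B) hB.1 hBm).comp measurable_swap

lemma integrable_prod (hB : IsBrownianPillow B) (hν₁ : GeneratesMeasure1 t₁d ν₁)
    (hν₂ : GeneratesMeasure1 t₂d ν₂) (ω : Ω) :
    Integrable (fun q => B q ω) (ν₁.prod ν₂) := by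
  have := hν₁.2.2.1
  have := hν₂.2.2.1
  rw [← Measure.restrict_eq_self_of_ae_mem (hν₁.ae_mem_unitSq hν₂)]
  exact (hB.1 ω).continuousOn.integrableOn_compact isCompact_unitSq

lemma psi_congr (hae : ∀ᵐ ω, ∀ p, B' p ω = B p ω) (u h : ℝ × ℝ → ℝ) :
    psi B' u h = psi B u h := by
  refine congrArg ENNReal.toReal (measure_congr ?_)
  filter_upwards [hae] with ω hω
  exact propext (forall₂_congr fun p _ => by rw [hω p])

variable [IsProbabilityMeasure (ℙ : Measure Ω)]

lemma integral_mul_integral (hB : IsBrownianPillow B) (hBm : ∀ p, Measurable (B p))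
    (hν₁ : GeneratesMeasure1 t₁d ν₁) (hν₂ : GeneratesMeasure1 t₂d ν₂) {W : Ω → ℝ}
    (hW : MemLp W 2 ℙ) :
    ∫ ω, W ω * ∫ q, B q ω ∂(ν₁.prod ν₂) = ∫ q, ∫ ω, W ω * B q ω ∂ℙ ∂(ν₁.prod ν₂) := by
  have := hν₁.2.2.1
  have := hν₂.2.2.1
  refine integral_mul_integral_comm (hB.measurable_uncurry hBm) (C := 1) ?_ hW
  filter_upwards [hν₁.ae_mem_unitSq hν₂] with q hq
  refine ⟨(hB.isCenteredGaussianSpace.hasGaussianLaw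
    (Submodule.subset_span (mem_range_self q))).memLp_two, ?_⟩
  obtain ⟨⟨h1, h2⟩, h3, h4⟩ := hq
  rw [hB.2.2 q ⟨⟨h1, h2⟩, h3, h4⟩ q ⟨⟨h1, h2⟩, h3, h4⟩, min_self, min_self]
  refine mul_le_one₀ ?_ ?_ ?_ <;> nlinarith

lemma covariance_integral (hB : IsBrownianPillow B) (hBm : ∀ p, Measurable (B p))
    (ht₁ : IsH10 t₁ t₁d) (ht₂ : IsH10 t₂ t₂d)
    (hν₁ : GeneratesMeasure1 t₁d ν₁) (hν₂ : GeneratesMeasure1 t₂d ν₂) {p : ℝ × ℝ}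
    (hp : p ∈ unitSq) :
    ∫ ω, B p ω * ∫ q, B q ω ∂(ν₁.prod ν₂) = t₁ p.1 * t₂ p.2 := by
  rw [hB.integral_mul_integral hBm hν₁ hν₂ (hB.isCenteredGaussianSpace.hasGaussianLaw
    (Submodule.subset_span (mem_range_self p))).memLp_two]
  have := hν₁.2.2.1
  have := hν₂.2.2.1
  rw [ht₁.eq_integral_kernel hν₁ hp.1, ht₂.eq_integral_kernel hν₂ hp.2, ← integral_prod_mul]
  refine integral_congr_ae ?_
  filter_upwards [hν₁.ae_mem_unitSq hν₂] with q hq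
  exact hB.2.2 p hp q hq

lemma variance_integral (hB : IsBrownianPillow B) (hBm : ∀ p, Measurable (B p))
    (ht₁ : IsH10 t₁ t₁d) (ht₂ : IsH10 t₂ t₂d)
    (hν₁ : GeneratesMeasure1 t₁d ν₁) (hν₂ : GeneratesMeasure1 t₂d ν₂) :
    ∫ ω, (∫ q, B q ω ∂(ν₁.prod ν₂)) * ∫ q, B q ω ∂(ν₁.prod ν₂)
      = norm1 t₁d ^ 2 * norm1 t₂d ^ 2 := by
  have := hν₁.2.2.1
  have := hν₂.2.2.1
  have hmem := integral_mem_seqLimits (μ := ν₁.prod ν₂) isCompact_unitSq unitSq_nonempty hB.1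
    (hν₁.ae_mem_unitSq hν₂)
  rw [hB.integral_mul_integral hBm hν₁ hν₂
    (hB.isCenteredGaussianSpace.seqLimits.hasGaussianLaw hmem).memLp_two,
    ← ht₁.integral_eq_norm1_sq hν₁, ← ht₂.integral_eq_norm1_sq hν₂, ← integral_prod_mul]
  refine integral_congr_ae ?_
  filter_upwards [hν₁.ae_mem_unitSq hν₂] with q hq
  rw [← hB.covariance_integral hBm ht₁ ht₂ hν₁ hν₂ hq]
  simp_rw [mul_comm]

lemma continuousOn_mul (ht₁ : IsH10 t₁ t₁d) (ht₂ : IsH10 t₂ t₂d)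
    (hν₁ : GeneratesMeasure1 t₁d ν₁) (hν₂ : GeneratesMeasure1 t₂d ν₂) :
    ContinuousOn (fun p : ℝ × ℝ => t₁ p.1 * t₂ p.2) unitSq :=
  ((ht₁.continuousOn_of_integrableOn hν₁.integrableOn).comp continuousOn_fst
    fun _ hp => hp.1).mul
  ((ht₂.continuousOn_of_integrableOn hν₂.integrableOn).comp continuousOn_snd fun _ hp => hp.2)

/-- Cameron–Martin formula for the boundary crossing events of the Brownian pillow with trend
`t₁ × t₂`. -/
lemma measure_forall_add_le (hB : IsBrownianPillow B) (hBm : ∀ p, Measurable (B p))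
    (ht₁ : IsH10 t₁ t₁d) (ht₂ : IsH10 t₂ t₂d)
    (hν₁ : GeneratesMeasure1 t₁d ν₁) (hν₂ : GeneratesMeasure1 t₂d ν₂) (g : ℝ × ℝ → ℝ) :
    ℙ {ω | ∀ p ∈ unitSq, B p ω + t₁ p.1 * t₂ p.2 ≤ g p}
      = ∫⁻ ω in {ω | ∀ p ∈ unitSq, B p ω ≤ g p}, ENNReal.ofReal (Real.exp
          ((∫ q, B q ω ∂(ν₁.prod ν₂)) - norm1 t₁d ^ 2 * norm1 t₂d ^ 2 / 2)) := by
  have := hν₁.2.2.1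
  have := hν₂.2.2.1
  have hmem := integral_mem_seqLimits (μ := ν₁.prod ν₂) isCompact_unitSq unitSq_nonempty hB.1
    (hν₁.ae_mem_unitSq hν₂)
  obtain ⟨D, hDK, hDc, hD⟩ := exists_countable_forall_le_iff unitSq g
  have hDc' := hDc.to_subtype
  have hZm : Measurable fun ω => ∫ q, B q ω ∂(ν₁.prod ν₂) :=
    ((hB.measurable_uncurry hBm).stronglyMeasurable.integral_prod_right').measurable
  have key := cameronMartin (T := D) (X := fun p => B p) hB.isCenteredGaussianSpace.seqLimits
    (fun p => le_seqLimits _ (Submodule.subset_span (mem_range_self (p : ℝ × ℝ)))) hmem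
    (fun p => hBm p) hZm (a := fun p => t₁ (p : ℝ × ℝ).1 * t₂ (p : ℝ × ℝ).2)
    (fun p => hB.covariance_integral hBm ht₁ ht₂ hν₁ hν₂ (hDK p.2))
    (hB.variance_integral hBm ht₁ ht₂ hν₁ hν₂)
    (A := {x | ∀ p : D, x p ≤ g p}) (by
      simp only [ofPred_forall]
      exact MeasurableSet.iInter fun p =>
        measurableSet_le (measurable_pi_apply p) measurable_const)
  have e1 : {ω | ∀ p ∈ unitSq, B p ω + t₁ p.1 * t₂ p.2 ≤ g p}
      = {ω | (fun p : D => B p ω + t₁ (p : ℝ × ℝ).1 * t₂ (p : ℝ × ℝ).2)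
          ∈ {x : D → ℝ | ∀ p : D, x p ≤ g p}} := by
    ext ω
    simp only [mem_ofPred_eq, Subtype.forall]
    exact hD _ ((hB.1 ω).continuousOn.add (continuousOn_mul ht₁ ht₂ hν₁ hν₂))
  have e2 : {ω | ∀ p ∈ unitSq, B p ω ≤ g p}
      = {ω | (fun p : D => B p ω) ∈ {x : D → ℝ | ∀ p : D, x p ≤ g p}} := by
    ext ω
    simp only [mem_ofPred_eq, Subtype.forall]
    exact hD _ (hB.1 ω).continuousOn
  rw [e1, e2]
  exact key

lemma psi_le_psi_mul_exp (hB : IsBrownianPillow B) (hBm : ∀ p, Measurable (B p))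
    {h₁ h₁d h₂ h₂d u₁ u₂ : ℝ → ℝ} (hh₁ : IsH10 h₁ h₁d) (hh₂ : IsH10 h₂ h₂d)
    (hscm₁ : IsSCM h₁ t₁) (hscm₂ : IsSCM h₂ t₂) (ht₁ : IsH10 t₁ t₁d) (ht₂ : IsH10 t₂ t₂d)
    (hν₁ : GeneratesMeasure1 t₁d ν₁) (hν₂ : GeneratesMeasure1 t₂d ν₂)
    (hu₁ : Integrable u₁ ν₁) (hu₂ : Integrable u₂ ν₂) :
    psi B (fun p => u₁ p.1 * u₂ p.2) (fun p => h₁ p.1 * h₂ p.2) ≤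
      psi B (fun p => u₁ p.1 * u₂ p.2) (fun p => h₁ p.1 * h₂ p.2 - t₁ p.1 * t₂ p.2) *
        Real.exp (-(norm1 t₁d ^ 2 * norm1 t₂d ^ 2) / 2 +
          (∫ x, u₁ x ∂ν₁) * ∫ x, u₂ x ∂ν₂) := by
  have := hν₁.2.2.1
  have := hν₂.2.2.1
  set g : ℝ × ℝ → ℝ := fun p => u₁ p.1 * u₂ p.2 - (h₁ p.1 * h₂ p.2 - t₁ p.1 * t₂ p.2) with hg
  have e1 : {ω | ∀ p ∈ unitSq, B p ω + h₁ p.1 * h₂ p.2 ≤ u₁ p.1 * u₂ p.2}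
      = {ω | ∀ p ∈ unitSq, B p ω + t₁ p.1 * t₂ p.2 ≤ g p} := by
    ext ω
    refine forall₂_congr fun p _ => ?_
    rw [hg]
    constructor <;> intro h <;> linarith
  have e2 : {ω | ∀ p ∈ unitSq, B p ω + (h₁ p.1 * h₂ p.2 - t₁ p.1 * t₂ p.2) ≤ u₁ p.1 * u₂ p.2}
      = {ω | ∀ p ∈ unitSq, B p ω ≤ g p} := by
    ext ω
    refine forall₂_congr fun p _ => ?_
    rw [hg]
    constructor <;> intro h <;> linarith
  rw [psi, psi, e1, e2, hB.measure_forall_add_le hBm ht₁ ht₂ hν₁ hν₂,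
    ← ENNReal.toReal_ofReal (Real.exp_nonneg _), ← ENNReal.toReal_mul, mul_comm (ℙ _)]
  refine ENNReal.toReal_mono (ENNReal.mul_ne_top ENNReal.ofReal_ne_top (measure_ne_top _ _)) ?_
  rw [← setLIntegral_const]
  refine setLIntegral_mono measurable_const fun ω hω => ?_
  refine ENNReal.ofReal_le_ofReal (Real.exp_le_exp.2 ?_)
  have hle : ∫ q, B q ω ∂(ν₁.prod ν₂) ≤ (∫ x, u₁ x ∂ν₁) * ∫ x, u₂ x ∂ν₂ := by
    rw [← integral_prod_mul]
    refine integral_mono_ae (hB.integrable_prod hν₁ hν₂ ω) (hu₁.mul_prod hu₂) ?_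
    filter_upwards [hν₁.ae_mem_unitSq hν₂, hν₂.ae_prod_fst (hscm₁.ae_eq hh₁ ht₁ hν₁),
      hν₂.ae_prod_snd (hscm₂.ae_eq hh₂ ht₂ hν₂)] with q hq hq1 hq2
    have := hω q hq
    simpa only [hg, hq1, hq2, sub_self, sub_zero] using this
  linarith

lemma mul_exp_le_psi (hB : IsBrownianPillow B) (hBm : ∀ p, Measurable (B p))
    {h₁ h₂ u₁ u₂ l₁ l₂ : ℝ → ℝ} (ht₁ : IsH10 t₁ t₁d) (ht₂ : IsH10 t₂ t₂d)
    (hmaj : ∀ p ∈ unitSq, h₁ p.1 * h₂ p.2 ≤ t₁ p.1 * t₂ p.2)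
    (hν₁ : GeneratesMeasure1 t₁d ν₁) (hν₂ : GeneratesMeasure1 t₂d ν₂)
    (hl₁ : Integrable l₁ ν₁) (hl₂ : Integrable l₂ ν₂) :
    (ℙ {ω | ∀ p ∈ unitSq, l₁ p.1 * l₂ p.2 ≤ B p ω ∧ B p ω ≤ u₁ p.1 * u₂ p.2}).toReal *
        Real.exp (-(norm1 t₁d ^ 2 * norm1 t₂d ^ 2) / 2 +
          (∫ x, l₁ x ∂ν₁) * ∫ x, l₂ x ∂ν₂) ≤
      psi B (fun p => u₁ p.1 * u₂ p.2) (fun p => h₁ p.1 * h₂ p.2) := by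
  have := hν₁.2.2.1
  have := hν₂.2.2.1
  have hmeas : MeasurableSet {ω | ∀ p ∈ unitSq,
      l₁ p.1 * l₂ p.2 ≤ B p ω ∧ B p ω ≤ u₁ p.1 * u₂ p.2} := by
    have h1 := measurableSet_forall_le (K := unitSq) hBm (fun ω => (hB.1 ω).continuousOn)
      fun p => u₁ p.1 * u₂ p.2
    have h2 := measurableSet_forall_le (K := unitSq) (fun p => (hBm p).neg)
      (fun ω => (hB.1 ω).neg.continuousOn) fun p => -(l₁ p.1 * l₂ p.2)
    convert h2.inter h1 using 1
    ext ω
    simp only [mem_inter_iff, mem_ofPred_eq, Pi.neg_apply, neg_le_neg_iff, forall_and]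
  rw [psi, ← ENNReal.toReal_ofReal (Real.exp_nonneg _), ← ENNReal.toReal_mul, mul_comm (ℙ _)]
  refine ENNReal.toReal_mono (measure_ne_top _ _) ?_
  calc _ = ∫⁻ ω in {ω | ∀ p ∈ unitSq, l₁ p.1 * l₂ p.2 ≤ B p ω ∧ B p ω ≤ u₁ p.1 * u₂ p.2},
        ENNReal.ofReal (Real.exp (-(norm1 t₁d ^ 2 * norm1 t₂d ^ 2) / 2 +
          (∫ x, l₁ x ∂ν₁) * ∫ x, l₂ x ∂ν₂)) := (setLIntegral_const _ _).symm
    _ ≤ ∫⁻ ω in {ω | ∀ p ∈ unitSq, l₁ p.1 * l₂ p.2 ≤ B p ω ∧ B p ω ≤ u₁ p.1 * u₂ p.2},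
        ENNReal.ofReal (Real.exp
          ((∫ q, B q ω ∂(ν₁.prod ν₂)) - norm1 t₁d ^ 2 * norm1 t₂d ^ 2 / 2)) := by
      refine setLIntegral_mono' hmeas fun ω hω => ?_
      refine ENNReal.ofReal_le_ofReal (Real.exp_le_exp.2 ?_)
      have hle : (∫ x, l₁ x ∂ν₁) * ∫ x, l₂ x ∂ν₂ ≤ ∫ q, B q ω ∂(ν₁.prod ν₂) := by
        rw [← integral_prod_mul]
        refine integral_mono_ae (hl₁.mul_prod hl₂) (hB.integrable_prod hν₁ hν₂ ω) ?_
        filter_upwards [hν₁.ae_mem_unitSq hν₂] with q hq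
        exact (hω q hq).1
      linarith
    _ ≤ ∫⁻ ω in {ω | ∀ p ∈ unitSq, B p ω ≤ u₁ p.1 * u₂ p.2},
        ENNReal.ofReal (Real.exp
          ((∫ q, B q ω ∂(ν₁.prod ν₂)) - norm1 t₁d ^ 2 * norm1 t₂d ^ 2 / 2)) :=
      lintegral_mono_set fun ω hω p hp => (hω p hp).2
    _ = ℙ {ω | ∀ p ∈ unitSq, B p ω + t₁ p.1 * t₂ p.2 ≤ u₁ p.1 * u₂ p.2} :=
      (hB.measure_forall_add_le hBm ht₁ ht₂ hν₁ hν₂ fun p => u₁ p.1 * u₂ p.2).symm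
    _ ≤ _ := measure_mono fun ω (hω : ∀ p ∈ unitSq, _) p hp =>
      (add_le_add_right (hmaj p hp) _).trans (hω p hp)

end IsBrownianPillow

end BrownianPillow

/-- Let `h₁, h₂ ∈ H¹₀` with smallest concave majorants `h̃₁, h̃₂ ∈ H¹₀` and
`h̃₁(s)h̃₂(t) ≥ h₁(s)h₂(t)` on `[0,1]²`. Let `νᵢ` be the Lebesgue–Stieltjes measure generated
by `−h̃ᵢ'` and let `uᵢ, lᵢ` be measurable and `νᵢ`-integrable. With `h := h₁×h₂`,
`h̃ := h̃₁×h̃₂`, `u := u₁×u₂` and `ψ(u;0) ∈ (0,1)`: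
`ψ(u;h) ≤ ψ(u; h−h̃)·exp(−‖h̃₁‖²‖h̃₂‖²/2 + ∏ᵢ ∫ uᵢ dνᵢ)` and
`ψ(u;h) ≥ P(l₁(s)l₂(t) ≤ B₀(s,t) ≤ u₁(s)u₂(t) ∀ s,t)·exp(−‖h̃₁‖²‖h̃₂‖²/2 + ∏ᵢ ∫ lᵢ dνᵢ)`. -/
theorem stmt18 {Ω : Type*} [MeasureSpace Ω] [IsProbabilityMeasure (ℙ : Measure Ω)]
    (B : ℝ × ℝ → Ω → ℝ) (hB : IsBrownianPillow B)
    (h₁ h₁d h₂ h₂d t₁ t₁d t₂ t₂d : ℝ → ℝ)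
    (hh₁ : IsH10 h₁ h₁d) (hh₂ : IsH10 h₂ h₂d)
    (hscm₁ : IsSCM h₁ t₁) (hscm₂ : IsSCM h₂ t₂)
    (ht₁ : IsH10 t₁ t₁d) (ht₂ : IsH10 t₂ t₂d)
    (hmaj : ∀ p ∈ unitSq, h₁ p.1 * h₂ p.2 ≤ t₁ p.1 * t₂ p.2)
    (ν₁ ν₂ : Measure ℝ)
    (hν₁ : GeneratesMeasure1 t₁d ν₁) (hν₂ : GeneratesMeasure1 t₂d ν₂)
    (u₁ u₂ l₁ l₂ : ℝ → ℝ)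
    (hu₁ : Measurable u₁) (hu₂ : Measurable u₂)
    (hl₁ : Measurable l₁) (hl₂ : Measurable l₂)
    (hu₁int : Integrable u₁ ν₁) (hu₂int : Integrable u₂ ν₂)
    (hl₁int : Integrable l₁ ν₁) (hl₂int : Integrable l₂ ν₂)
    (hpsi : psi B (fun p => u₁ p.1 * u₂ p.2) 0 ∈ Ioo (0:ℝ) 1) :
    psi B (fun p => u₁ p.1 * u₂ p.2) (fun p => h₁ p.1 * h₂ p.2) ≤
      psi B (fun p => u₁ p.1 * u₂ p.2) (fun p => h₁ p.1 * h₂ p.2 - t₁ p.1 * t₂ p.2) *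
        Real.exp (-(norm1 t₁d ^ 2 * norm1 t₂d ^ 2) / 2 +
          (∫ x, u₁ x ∂ν₁) * ∫ x, u₂ x ∂ν₂) ∧
    (ℙ {ω | ∀ p ∈ unitSq, l₁ p.1 * l₂ p.2 ≤ B p ω ∧ B p ω ≤ u₁ p.1 * u₂ p.2}).toReal *
        Real.exp (-(norm1 t₁d ^ 2 * norm1 t₂d ^ 2) / 2 +
          (∫ x, l₁ x ∂ν₁) * ∫ x, l₂ x ∂ν₂) ≤
      psi B (fun p => u₁ p.1 * u₂ p.2) (fun p => h₁ p.1 * h₂ p.2) := by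
  obtain ⟨B', hB'm, hB'c, hae⟩ := exists_measurable_modification hB.1 hB.aemeasurable
  have hB' : IsBrownianPillow B' := hB.congr hB'c hae
  have hset : ℙ {ω | ∀ p ∈ unitSq, l₁ p.1 * l₂ p.2 ≤ B p ω ∧ B p ω ≤ u₁ p.1 * u₂ p.2}
      = ℙ {ω | ∀ p ∈ unitSq, l₁ p.1 * l₂ p.2 ≤ B' p ω ∧ B' p ω ≤ u₁ p.1 * u₂ p.2} := by
    refine measure_congr ?_
    filter_upwards [hae] with ω hω
    exact propext (forall₂_congr fun p _ => by rw [hω p])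
  rw [hset]
  simp only [← IsBrownianPillow.psi_congr hae]
  exact ⟨hB'.psi_le_psi_mul_exp hB'm hh₁ hh₂ hscm₁ hscm₂ ht₁ ht₂ hν₁ hν₂ hu₁int hu₂int,
    hB'.mul_exp_le_psi hB'm ht₁ ht₂ hmaj hν₁ hν₂ hl₁int hl₂int⟩

end
end
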